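/- arXiv:2009.11167 — 4 statements merged into one kernel-verified Lean document; each statement's English description precedes it below -/
import Mathlib

section
/- Let (W,X) be a pair of positive random variables with P(X>0)>0 (X non-trivial), c>0, and 1 ≤ p < ∞. For any measurable h:(0,∞)²→ℝ with ‖h‖ := sup_{t>0} ∫_0^∞ |h(u,t)|^p du < ∞, the function Kh defined by (Kh)(u,t) = E[ 1_{{W < min(t, u/c)}} · h( e^{X}(u−cW), t−W ) ] satisfies sup_{t>0} ∫_0^∞ |(Kh)(u,t)|^p du ≤ E[e^{−X}] · sup_{t>0} ∫_0^∞ |h(u,t)|^p du, and E[e^{−X}] < 1; in particular the operator norm of K on this space is strictly less than 1. -/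
open MeasureTheory ProbabilityTheory Real Set Filter

/-- The cash-flow process `U_t` built from inter-arrival times `W i` and effects `X i`
(indexed so that `W i`, `X i` are the `(i+1)`-th variables of the paper). -/
noncomputable def cashFlow {Ω : Type*} (c : ℝ) (W X : ℕ → Ω → ℝ) (t : ℝ) (ω : Ω) : ℝ :=
  c * ∑' n : ℕ,
    Set.indicator
      (Set.Ico (∑ i ∈ Finset.range n, W i ω) (∑ i ∈ Finset.range (n + 1), W i ω))
      (fun s => (s - ∑ i ∈ Finset.range n, W i ω) * Real.exp (-∑ i ∈ Finset.range n, X i ω)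
        + ∑ i ∈ Finset.range n, W i ω * Real.exp (-∑ k ∈ Finset.range i, X k ω)) t

/-- The operator `K` of the paper: `(Kh)(u,t) = E[1_{W < min(t,u/c)} h(e^X (u - cW), t - W)]`. -/
noncomputable def Kop {Ω : Type*} [MeasureSpace Ω] (c : ℝ) (W X : Ω → ℝ)
    (h : ℝ → ℝ → ℝ) (u t : ℝ) : ℝ :=
  ∫ ω, (if W ω < min t (u / c) then h (Real.exp (X ω) * (u - c * W ω)) (t - W ω) else 0)
    ∂(ℙ : Measure Ω)

/-- The operator `K_∞` of the paper: `(K_∞ g)(u) = E[1_{cW < u} g(e^X (u - cW))]`. -/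
noncomputable def Kinf {Ω : Type*} [MeasureSpace Ω] (c : ℝ) (W X : Ω → ℝ)
    (g : ℝ → ℝ) (u : ℝ) : ℝ :=
  ∫ ω, (if c * W ω < u then g (Real.exp (X ω) * (u - c * W ω)) else 0) ∂(ℙ : Measure Ω)

/-- Jensen's inequality for the norm of an integral over a probability space. -/
theorem enorm_integral_rpow_le {Ω : Type*} [MeasurableSpace Ω] (μ : Measure Ω)
    [IsProbabilityMeasure μ] {f : Ω → ℝ} (hf : AEStronglyMeasurable f μ) {p : ℝ} (hp : 1 ≤ p) :
    ‖∫ ω, f ω ∂μ‖ₑ ^ p ≤ ∫⁻ ω, ‖f ω‖ₑ ^ p ∂μ := by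
  have hp0 : 0 < p := by linarith
  have key := eLpNorm'_le_eLpNorm'_of_exponent_le one_pos hp μ hf
  simp only [eLpNorm', ENNReal.rpow_one, div_one] at key
  calc ‖∫ ω, f ω ∂μ‖ₑ ^ p ≤ ((∫⁻ ω, ‖f ω‖ₑ ^ p ∂μ) ^ (1 / p)) ^ p :=
        ENNReal.rpow_le_rpow ((enorm_integral_le_lintegral_enorm f).trans key) hp0.le
    _ = ∫⁻ ω, ‖f ω‖ₑ ^ p ∂μ := by
        rw [← ENNReal.rpow_mul, one_div_mul_cancel hp0.ne', ENNReal.rpow_one]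

/-- Affine change of variables for the Lebesgue integral on the real line. -/
theorem lintegral_comp_mul_sub {G : ℝ → ENNReal} (hG : Measurable G) {a : ℝ} (ha : 0 < a)
    (b : ℝ) : ∫⁻ u, G (a * (u - b)) = ENNReal.ofReal a⁻¹ * ∫⁻ u, G u := by
  rw [lintegral_sub_right_eq_self (fun u => G (a * u)) b,
    ← lintegral_map hG (measurable_const_mul a), Real.map_volume_mul_left ha.ne',
    lintegral_smul_measure, abs_of_pos (inv_pos.2 ha), smul_eq_mul]

theorem ofReal_abs_rpow (x : ℝ) {p : ℝ} (hp : 0 ≤ p) :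
    ENNReal.ofReal (|x| ^ p) = ‖x‖ₑ ^ p := by
  rw [← ENNReal.ofReal_rpow_of_nonneg (abs_nonneg x) hp, Real.enorm_eq_ofReal_abs]

theorem integrable_exp_neg_of_nonneg {Ω : Type*} [MeasurableSpace Ω] (μ : Measure Ω)
    [IsFiniteMeasure μ] {X : Ω → ℝ} (hX : Measurable X) (hX0 : ∀ ω, 0 ≤ X ω) :
    Integrable (fun ω => Real.exp (-X ω)) μ :=
  Integrable.of_bound (by fun_prop) 1 (Eventually.of_forall fun ω => by
    simpa using hX0 ω)

theorem integral_exp_neg_lt_one {Ω : Type*} [MeasurableSpace Ω] (μ : Measure Ω)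
    [IsProbabilityMeasure μ] {X : Ω → ℝ} (hX : Measurable X) (hX0 : ∀ ω, 0 ≤ X ω)
    (hpos : 0 < μ {ω | 0 < X ω}) : ∫ ω, Real.exp (-X ω) ∂μ < 1 := by
  have hint := integrable_exp_neg_of_nonneg μ hX hX0
  have hlt : 0 < ∫ ω, (1 - Real.exp (-X ω)) ∂μ := by
    refine (integral_pos_iff_support_of_nonneg (fun ω => by simpa using hX0 ω)
      ((integrable_const 1).sub hint)).2 ?_
    refine hpos.trans_le (measure_mono fun ω hω => ?_)
    have : Real.exp (-X ω) < 1 := by simpa using hω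
    exact (sub_pos.2 this).ne'
  rw [integral_sub (integrable_const 1) hint] at hlt
  simpa using hlt

/-- Lemma 2.3 (contraction property of `K` on `A_p`). -/
theorem stmt2 {Ω : Type*} [MeasureSpace Ω] [IsProbabilityMeasure (ℙ : Measure Ω)]
    (c : ℝ) (hc : 0 < c)
    (W₀ X₀ : Ω → ℝ) (hW₀ : Measurable W₀) (hX₀ : Measurable X₀)
    (hW₀pos : ∀ ω, 0 < W₀ ω) (hX₀pos : ∀ ω, 0 < X₀ ω)
    (hXnontriv : 0 < ℙ {ω | 0 < X₀ ω})
    (p : ℝ) (hp : 1 ≤ p)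
    (h : ℝ → ℝ → ℝ) (hmeas : Measurable (Function.uncurry h))
    (hnorm : (⨆ t ∈ Set.Ioi (0 : ℝ),
        ∫⁻ u in Set.Ioi (0 : ℝ), ENNReal.ofReal (|h u t| ^ p)) < ⊤) :
    (⨆ t ∈ Set.Ioi (0 : ℝ),
        ∫⁻ u in Set.Ioi (0 : ℝ), ENNReal.ofReal (|Kop c W₀ X₀ h u t| ^ p))
      ≤ ENNReal.ofReal (∫ ω, Real.exp (-X₀ ω) ∂(ℙ : Measure Ω)) *
        (⨆ t ∈ Set.Ioi (0 : ℝ),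
          ∫⁻ u in Set.Ioi (0 : ℝ), ENNReal.ofReal (|h u t| ^ p))
    ∧ (∫ ω, Real.exp (-X₀ ω) ∂(ℙ : Measure Ω)) < 1 := by
  have hp0 : 0 ≤ p := by linarith
  refine ⟨?_, integral_exp_neg_lt_one ℙ hX₀ (fun ω => (hX₀pos ω).le) hXnontriv⟩
  simp only [ofReal_abs_rpow _ hp0]
  set S := ⨆ t ∈ Set.Ioi (0 : ℝ), ∫⁻ u in Set.Ioi (0 : ℝ), ‖h u t‖ₑ ^ p
  refine iSup₂_le fun t _ => ?_
  set F : ℝ → Ω → ℝ := fun u ω =>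
    if W₀ ω < min t (u / c) then h (Real.exp (X₀ ω) * (u - c * W₀ ω)) (t - W₀ ω) else 0 with hF
  have hFmeas : Measurable (Function.uncurry F) := by
    refine Measurable.ite (measurableSet_lt (by fun_prop) (by fun_prop)) ?_ measurable_const
    exact hmeas.comp (f := fun q : ℝ × Ω =>
      (Real.exp (X₀ q.2) * (q.1 - c * W₀ q.2), t - W₀ q.2)) (by fun_prop)
  have hslice (ω : Ω) :
      ∫⁻ u in Set.Ioi (0 : ℝ), ‖F u ω‖ₑ ^ p ≤ ENNReal.ofReal (Real.exp (-X₀ ω)) * S := by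
    by_cases hW : W₀ ω < t
    · let G : ℝ → ENNReal := (Set.Ioi (0 : ℝ)).indicator fun v => ‖h v (t - W₀ ω)‖ₑ ^ p
      have hG : Measurable G :=
        ((hmeas.comp (measurable_id.prodMk measurable_const)).enorm.pow_const p).indicator
          measurableSet_Ioi
      calc ∫⁻ u in Set.Ioi (0 : ℝ), ‖F u ω‖ₑ ^ p ≤ ∫⁻ u, ‖F u ω‖ₑ ^ p :=
            setLIntegral_le_lintegral _ _
        _ ≤ ∫⁻ u, G (Real.exp (X₀ ω) * (u - c * W₀ ω)) := by
            refine lintegral_mono fun u => ?_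
            by_cases hu : W₀ ω < min t (u / c)
            · have hu' : 0 < u - c * W₀ ω := by
                have := (lt_div_iff₀ hc).1 (lt_min_iff.1 hu).2
                linarith
              have hmem : Real.exp (X₀ ω) * (u - c * W₀ ω) ∈ Set.Ioi (0 : ℝ) :=
                mul_pos (Real.exp_pos _) hu'
              simp only [hF, G, if_pos hu, Set.indicator_of_mem hmem, le_refl]
            · simp only [hF, if_neg hu, enorm_zero, ENNReal.zero_rpow_of_pos (by linarith : 0 < p),
                zero_le]
        _ = ENNReal.ofReal (Real.exp (-X₀ ω)) *
              ∫⁻ u in Set.Ioi (0 : ℝ), ‖h u (t - W₀ ω)‖ₑ ^ p := by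
            rw [lintegral_comp_mul_sub hG (Real.exp_pos _), Real.exp_neg,
              lintegral_indicator measurableSet_Ioi]
        _ ≤ ENNReal.ofReal (Real.exp (-X₀ ω)) * S := by
            gcongr
            exact le_iSup₂ (f := fun t (_ : t ∈ Set.Ioi (0 : ℝ)) =>
              ∫⁻ u in Set.Ioi (0 : ℝ), ‖h u t‖ₑ ^ p) (t - W₀ ω) (sub_pos.2 hW)
    · simp [hF, hW, show 0 < p by linarith]
  calc ∫⁻ u in Set.Ioi (0 : ℝ), ‖Kop c W₀ X₀ h u t‖ₑ ^ p
      ≤ ∫⁻ u in Set.Ioi (0 : ℝ), ∫⁻ ω, ‖F u ω‖ₑ ^ p ∂ℙ :=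
        lintegral_mono fun u => enorm_integral_rpow_le ℙ
          (hFmeas.comp measurable_prodMk_left).aestronglyMeasurable hp
    _ = ∫⁻ ω, (∫⁻ u in Set.Ioi (0 : ℝ), ‖F u ω‖ₑ ^ p) ∂ℙ :=
        lintegral_lintegral_swap (hFmeas.enorm.pow_const p).aemeasurable
    _ ≤ ∫⁻ ω, ENNReal.ofReal (Real.exp (-X₀ ω)) * S ∂ℙ := lintegral_mono hslice
    _ = ENNReal.ofReal (∫ ω, Real.exp (-X₀ ω) ∂ℙ) * S := by
        rw [lintegral_mul_const _ (by fun_prop), ofReal_integral_eq_lintegral_ofReal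
          (integrable_exp_neg_of_nonneg ℙ hX₀ fun ω => (hX₀pos ω).le)
          (Eventually.of_forall fun ω => (Real.exp_pos _).le)]
end

section
/- Let α>0, λ>0, c>0 and define Φ(u) = (1/Γ(α+1)) · ∫_0^{λu/c} z^α e^{−z} dz for u > 0. Then Φ satisfies the fixed-point integral equation Φ(u) = ∫_0^∞ ∫_0^{u/c} Φ( e^{x}(u − cw) ) · λα·e^{−λw − αx} dw dx for all u > 0, together with the boundary conditions Φ(0) = 0 and lim_{u→∞} Φ(u) = 1. -/
open MeasureTheory Real Set Filter

/-- The lower incomplete Gamma function `∫_0^y z^α e^{-z} dz`, with exponent `α` instead of the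
usual `α - 1`. -/
noncomputable def lowerGamma (α y : ℝ) : ℝ := ∫ z in (0 : ℝ)..y, z ^ α * Real.exp (-z)

theorem continuous_rpow_mul_exp_neg {α : ℝ} (hα : 0 < α) :
    Continuous fun z : ℝ => z ^ α * Real.exp (-z) :=
  (Real.continuous_rpow_const hα.le).mul (by fun_prop)

theorem hasDerivAt_lowerGamma {α : ℝ} (hα : 0 < α) (y : ℝ) :
    HasDerivAt (lowerGamma α) (y ^ α * Real.exp (-y)) y :=
  (continuous_rpow_mul_exp_neg hα).integral_hasStrictDerivAt 0 y |>.hasDerivAt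

theorem continuous_lowerGamma {α : ℝ} (hα : 0 < α) : Continuous (lowerGamma α) :=
  continuous_iff_continuousAt.2 fun y => (hasDerivAt_lowerGamma hα y).continuousAt

theorem integrableOn_rpow_mul_exp_neg {α : ℝ} (hα : 0 < α) :
    IntegrableOn (fun z : ℝ => z ^ α * Real.exp (-z)) (Ioi 0) := by
  simpa [mul_comm] using Real.GammaIntegral_convergent (s := α + 1) (by linarith)

theorem integral_rpow_mul_exp_neg {α : ℝ} (hα : 0 < α) :
    ∫ z in Ioi (0 : ℝ), z ^ α * Real.exp (-z) = Real.Gamma (α + 1) := by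
  rw [Real.Gamma_eq_integral (by linarith)]
  simp [mul_comm]

theorem tendsto_lowerGamma_atTop {α : ℝ} (hα : 0 < α) :
    Tendsto (lowerGamma α) atTop (nhds (Real.Gamma (α + 1))) := by
  rw [← integral_rpow_mul_exp_neg hα]
  exact intervalIntegral_tendsto_integral_Ioi 0 (integrableOn_rpow_mul_exp_neg hα) tendsto_id

theorem lowerGamma_nonneg (α : ℝ) {y : ℝ} (hy : 0 ≤ y) : 0 ≤ lowerGamma α y :=
  intervalIntegral.integral_nonneg hy fun _ hz =>
    mul_nonneg (Real.rpow_nonneg hz.1 _) (Real.exp_pos _).le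

theorem lowerGamma_le {α : ℝ} (hα : 0 < α) {y : ℝ} (hy : 0 ≤ y) :
    lowerGamma α y ≤ Real.Gamma (α + 1) := by
  rw [← integral_rpow_mul_exp_neg hα, lowerGamma, intervalIntegral.integral_of_le hy]
  refine setIntegral_mono_set (integrableOn_rpow_mul_exp_neg hα) ?_
    (Eventually.of_forall fun _ hz => hz.1)
  exact ae_restrict_of_forall_mem measurableSet_Ioi fun _ hz =>
    mul_nonneg (Real.rpow_nonneg (le_of_lt hz) _) (Real.exp_pos _).le

/-- The average of `lowerGamma α (e^x t)` over an exponential variable `x` of rate `α`. -/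
theorem integral_exp_mul_lowerGamma {α : ℝ} (hα : 0 < α) {t : ℝ} (ht : 0 < t) :
    ∫ x in Ioi (0 : ℝ), α * Real.exp (-(α * x)) * lowerGamma α (Real.exp x * t)
      = lowerGamma α t + t ^ α * Real.exp (-t) := by
  have hderiv : ∀ x : ℝ, HasDerivAt
      (fun x => -(Real.exp (-(α * x)) * lowerGamma α (Real.exp x * t))
        - t ^ α * Real.exp (-(Real.exp x * t)))
      (α * Real.exp (-(α * x)) * lowerGamma α (Real.exp x * t)) x := by
    intro x
    have he : HasDerivAt (fun x => Real.exp x * t) (Real.exp x * t) x :=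
      (Real.hasDerivAt_exp x).mul_const t
    have hl : HasDerivAt (fun x => -(α * x)) (-α) x := by
      simpa [Pi.neg_def] using ((hasDerivAt_id x).const_mul α).neg
    have h := (hl.exp.mul ((hasDerivAt_lowerGamma hα _).comp x he)).neg.sub
      (he.neg.exp.const_mul (t ^ α))
    refine h.congr_deriv ?_
    have hp : Real.exp (-(α * x)) * (Real.exp x * t) ^ α = t ^ α := by
      rw [Real.mul_rpow (Real.exp_pos x).le ht.le, ← Real.exp_mul, ← mul_assoc, ← Real.exp_add]
      simp [mul_comm]
    simp only [Function.comp_apply, Pi.neg_apply]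
    linear_combination (-Real.exp (-(Real.exp x * t)) * (Real.exp x * t)) * hp
  have he : Tendsto (fun x => Real.exp x * t) atTop atTop :=
    Real.tendsto_exp_atTop.atTop_mul_const ht
  have hlim : Tendsto (fun x => -(Real.exp (-(α * x)) * lowerGamma α (Real.exp x * t))
      - t ^ α * Real.exp (-(Real.exp x * t))) atTop (nhds 0) := by
    have h1 := (Real.tendsto_exp_neg_atTop_nhds_zero.comp
      (tendsto_id.const_mul_atTop hα)).mul ((tendsto_lowerGamma_atTop hα).comp he)
    have h2 := (Real.tendsto_exp_neg_atTop_nhds_zero.comp he).const_mul (t ^ α)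
    simpa using h1.neg.sub h2
  rw [integral_Ioi_of_hasDerivAt_of_nonneg' (fun x _ => hderiv x) (fun x _ => ?_) hlim]
  · simp
    ring
  · have := lowerGamma_nonneg α (y := Real.exp x * t) (by positivity)
    positivity

theorem integral_exp_sub_mul_lowerGamma {α : ℝ} (hα : 0 < α) (y : ℝ) :
    ∫ t in (0 : ℝ)..y, Real.exp (t - y) * (lowerGamma α t + t ^ α * Real.exp (-t))
      = lowerGamma α y := by
  rw [intervalIntegral.integral_eq_sub_of_hasDerivAt
    (f := fun t => Real.exp (t - y) * lowerGamma α t)]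
  · simp [lowerGamma]
  · intro t _
    refine (((hasDerivAt_id t).sub_const y).exp.mul (hasDerivAt_lowerGamma hα t)).congr_deriv ?_
    simp only [id]
    ring
  · refine Continuous.intervalIntegrable ?_ _ _
    have := continuous_lowerGamma hα
    have := continuous_rpow_mul_exp_neg hα
    fun_prop

/-- The fixed-point equation for `lowerGamma` in the normalised variables. -/
theorem integral_integral_lowerGamma {α : ℝ} (hα : 0 < α) {y : ℝ} (hy : 0 ≤ y) :
    ∫ x in Ioi (0 : ℝ), ∫ t in (0 : ℝ)..y,
        α * Real.exp (-(α * x)) * lowerGamma α (Real.exp x * t) * Real.exp (t - y)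
      = lowerGamma α y := by
  simp_rw [intervalIntegral.integral_of_le hy]
  rw [integral_integral_swap]
  · rw [← integral_exp_sub_mul_lowerGamma hα y, intervalIntegral.integral_of_le hy]
    refine setIntegral_congr_fun measurableSet_Ioc fun t ht => ?_
    rw [integral_mul_const, integral_exp_mul_lowerGamma hα ht.1, mul_comm]
  · have h1 : IntegrableOn (fun x : ℝ => α * Real.exp (-(α * x)) * Real.Gamma (α + 1)) (Ioi 0) := by
      simpa [IntegrableOn] using ((exp_neg_integrableOn_Ioi 0 hα).const_mul α).mul_const _
    have h2 : IntegrableOn (fun t : ℝ => Real.exp (t - y)) (Ioc 0 y) :=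
      (Continuous.integrableOn_Icc (by fun_prop)).mono_set Ioc_subset_Icc_self
    have hcont := continuous_lowerGamma hα
    refine (h1.integrable.mul_prod h2.integrable).mono'
      (Continuous.aestronglyMeasurable (by unfold Function.uncurry; fun_prop)) ?_
    rw [Measure.prod_restrict]
    refine ae_restrict_of_forall_mem (measurableSet_Ioi.prod measurableSet_Ioc) ?_
    rintro ⟨x, t⟩ ⟨-, ht⟩
    have hxt : 0 ≤ Real.exp x * t := mul_nonneg (Real.exp_pos x).le ht.1.le
    have h0 := lowerGamma_nonneg α hxt
    have hle := lowerGamma_le hα hxt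
    simp only [Function.uncurry_apply_pair]
    rw [Real.norm_of_nonneg (by positivity)]
    gcongr

/-- The regularized incomplete Gamma function `Φ(u) = Γ(α+1)⁻¹ ∫_0^{λu/c} z^α e^{-z} dz`
satisfies the fixed-point equation (3.3) with boundary conditions `Φ(0)=0`,
`Φ(∞)=1`. -/
theorem stmt14 (α lam c : ℝ) (hα : 0 < α) (hlam : 0 < lam) (hc : 0 < c)
    (Φ : ℝ → ℝ)
    (hΦ : ∀ u : ℝ, Φ u
      = (1 / Real.Gamma (α + 1)) * ∫ z in (0 : ℝ)..(lam * u / c), z ^ α * Real.exp (-z)) :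
    (∀ u : ℝ, 0 < u →
      Φ u = ∫ x in Set.Ioi (0 : ℝ),
              ∫ w in (0 : ℝ)..(u / c),
                Φ (Real.exp x * (u - c * w)) * (lam * α * Real.exp (-(lam * w) - α * x)))
    ∧ Φ 0 = 0
    ∧ Tendsto Φ atTop (nhds 1) := by
  replace hΦ : ∀ u, Φ u = 1 / Real.Gamma (α + 1) * lowerGamma α (lam * u / c) := hΦ
  refine ⟨fun u hu => ?_, by simp [hΦ, lowerGamma], ?_⟩
  · rw [hΦ, ← integral_integral_lowerGamma hα (by positivity), ← integral_const_mul]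
    refine setIntegral_congr_fun measurableSet_Ioi fun x _ => ?_
    have hsubst := intervalIntegral.mul_integral_comp_sub_mul (a := 0) (b := u / c)
      (f := fun t => α * Real.exp (-(α * x)) * lowerGamma α (Real.exp x * t) *
        Real.exp (t - lam * u / c)) lam (lam * u / c)
    rw [mul_zero, sub_zero, mul_div_assoc, sub_self] at hsubst
    rw [mul_div_assoc, ← hsubst, ← intervalIntegral.integral_const_mul,
      ← intervalIntegral.integral_const_mul]
    refine intervalIntegral.integral_congr fun w _ => ?_
    have harg : lam * (Real.exp x * (u - c * w)) / c
        = Real.exp x * (lam * (u / c) - lam * w) := by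
      field_simp
    have hexp : Real.exp (-(lam * w) - α * x)
        = Real.exp (-(α * x)) * Real.exp (lam * (u / c) - lam * w - lam * (u / c)) := by
      rw [← Real.exp_add]
      ring_nf
    simp only [hΦ, harg, hexp]
    ring
  · have hG : Real.Gamma (α + 1) ≠ 0 := (Real.Gamma_pos_of_pos (by linarith)).ne'
    have hlin : Tendsto (fun u => lam * u / c) atTop atTop :=
      (tendsto_id.const_mul_atTop hlam).atTop_div_const hc
    have h := ((tendsto_lowerGamma_atTop hα).comp hlin).const_mul (1 / Real.Gamma (α + 1))
    rw [one_div_mul_cancel hG] at h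
    exact h.congr fun u => (hΦ u).symm
end

section
/- Let α>0, c>0, k>0, θ>0. Then ∫_0^∞ [ (1/Γ(α+1)) · ∫_0^{λu/c} z^α e^{−z} dz ] · (1/(Γ(k)·θ^k))·λ^{k−1}·e^{−λ/θ} dλ = ( Γ(k+α+1) / (Γ(α+1)·Γ(k)) ) · B_{uθ/(c+uθ)}(α+1, k) for every u ≥ 0, where B_x(a,b) = ∫_0^x y^{a−1}(1−y)^{b−1} dy is the incomplete beta function. Equivalently, in the randomized-arrival model where W is conditionally Exponential(Λ) given Λ, with Λ Gamma-distributed with shape k and scale θ, and X ~ Exponential(α) independent, the infinite-time default probability is φ(u) = ( Γ(k+α+1)/(Γ(α+1)Γ(k)) )·B_{uθ/(c+uθ)}(α+1, k). -/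
open MeasureTheory Real Set Filter

/-- Rescaling the incomplete Gamma integral to a fixed range of integration. -/
lemma integral_rpow_mul_exp_neg_comp_mul {α l : ℝ} (hl : 0 < l) {p : ℝ} (hp : 0 ≤ p) :
    ∫ z in (0 : ℝ)..(l * p), z ^ α * exp (-z) =
      ∫ s in Ioc 0 p, l ^ (α + 1) * (s ^ α * exp (-(l * s))) := by
  have h := intervalIntegral.mul_integral_comp_mul_left (a := 0) (b := p)
    (f := fun z : ℝ => z ^ α * exp (-z)) l
  rw [mul_zero] at h
  rw [← h, ← intervalIntegral.integral_const_mul, intervalIntegral.integral_of_le hp]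
  refine setIntegral_congr_fun measurableSet_Ioc fun s hs => ?_
  rw [mul_rpow hl.le hs.1.le, rpow_add hl, rpow_one]
  ring

/-- Integrating out the rate: the Laplace transform of a power, applied under the integral. -/
lemma integral_Ioi_integral_Ioc_rpow_mul_exp_neg {α k b : ℝ} (hα : 0 < α) (hk : 0 < k)
    (hb : 0 < b) (p : ℝ) :
    ∫ l in Ioi (0 : ℝ), ∫ s in Ioc 0 p, s ^ α * (l ^ (k + α) * exp (-((s + b) * l))) =
      ∫ s in Ioc 0 p, s ^ α * ((1 / (s + b)) ^ (k + α + 1) * Gamma (k + α + 1)) := by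
  have laplace {s : ℝ} (hs : s ∈ Ioc 0 p) :
      ∫ l in Ioi (0 : ℝ), s ^ α * (l ^ (k + α) * exp (-((s + b) * l))) =
        s ^ α * ((1 / (s + b)) ^ (k + α + 1) * Gamma (k + α + 1)) := by
    have h := integral_rpow_mul_exp_neg_mul_Ioi (a := k + α + 1) (r := s + b) (by positivity)
      (add_pos hs.1 hb)
    rw [add_sub_cancel_right] at h
    rw [integral_const_mul, h]
  have hint : Integrable
      (Function.uncurry fun l s : ℝ => s ^ α * (l ^ (k + α) * exp (-((s + b) * l))))
      ((volume.restrict (Ioi 0)).prod (volume.restrict (Ioc 0 p))) := by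
    rw [integrable_prod_iff' (by
      apply Measurable.aestronglyMeasurable
      unfold Function.uncurry
      fun_prop)]
    constructor
    · filter_upwards [ae_restrict_mem measurableSet_Ioc] with s hs
      have h := integrableOn_rpow_mul_exp_neg_mul_rpow (p := 1) (s := k + α) (b := s + b)
        (by linarith) one_pos (add_pos hs.1 hb)
      simp only [rpow_one, neg_mul] at h
      exact h.integrable.const_mul (s ^ α)
    · have hcont : ContinuousOn
          (fun s : ℝ => s ^ α * ((1 / (s + b)) ^ (k + α + 1) * Gamma (k + α + 1)))
          (Icc 0 p) := by
        refine (continuousOn_id.rpow_const fun _ _ => Or.inr hα.le).mul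
          (ContinuousOn.mul (ContinuousOn.rpow_const (continuousOn_const.div (by fun_prop) ?_)
            fun _ _ => Or.inr (by positivity)) continuousOn_const)
        intro s hs
        exact (add_pos_of_nonneg_of_pos hs.1 hb).ne'
      refine ((hcont.integrableOn_Icc).mono_set Ioc_subset_Icc_self).congr ?_
      filter_upwards [ae_restrict_mem measurableSet_Ioc] with s hs
      rw [← laplace hs]
      refine setIntegral_congr_fun measurableSet_Ioi fun l hl => ?_
      have hl : 0 < l := hl
      have hs := hs.1
      exact (norm_of_nonneg (by positivity)).symm
  rw [integral_integral_swap hint]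
  exact setIntegral_congr_fun measurableSet_Ioc fun s hs => laplace hs

/-- The substitution `y = s * θ / (1 + s * θ)` in the incomplete Beta integral. -/
lemma integral_incompleteBeta_eq_integral_Ioc {α k θ p : ℝ} (hα : 0 < α) (hθ : 0 < θ)
    (hp : 0 ≤ p) :
    ∫ y in (0 : ℝ)..(p * θ / (1 + p * θ)), y ^ α * (1 - y) ^ (k - 1) =
      ∫ s in Ioc 0 p, s ^ α * (θ ^ (α + 1) * (1 / (1 + s * θ)) ^ (k + α + 1)) := by
  have hpos {s : ℝ} (hs : 0 ≤ s) : 0 < 1 + s * θ := by positivity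
  have hone {s : ℝ} (hs : 0 ≤ s) : 1 - s * θ / (1 + s * θ) = 1 / (1 + s * θ) := by
    have := hpos hs
    field_simp
    ring
  have h := intervalIntegral.integral_comp_mul_deriv' (a := 0) (b := p)
    (f := fun s => s * θ / (1 + s * θ)) (f' := fun s => θ / (1 + s * θ) ^ 2)
    (g := fun y => y ^ α * (1 - y) ^ (k - 1)) ?_ ?_ ?_
  · simp only [zero_mul, zero_div] at h
    rw [← h, intervalIntegral.integral_of_le hp]
    refine setIntegral_congr_fun measurableSet_Ioc fun s hs => ?_
    have hs0 := hs.1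
    have hd := hpos hs0.le
    simp only [Function.comp_apply]
    have hexp : (1 / (1 + s * θ)) ^ (k + α + 1) =
        (1 / (1 + s * θ)) ^ α * (1 / (1 + s * θ)) ^ (k - 1) * (1 / (1 + s * θ)) ^ 2 := by
      rw [← rpow_natCast, ← rpow_add (by positivity), ← rpow_add (by positivity)]
      congr 1
      push_cast
      ring
    rw [hone hs0.le, hexp, div_eq_mul_one_div (s * θ), mul_rpow (by positivity) (by positivity),
      mul_rpow hs0.le hθ.le, rpow_add hθ, rpow_one]
    generalize 1 + s * θ = d
    ring
  · intro s hs
    rw [uIcc_of_le hp] at hs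
    have hd := hpos hs.1
    have hn : HasDerivAt (fun s : ℝ => s * θ) θ s := hasDerivAt_mul_const θ
    refine (hn.div (hn.const_add 1) hd.ne').congr_deriv ?_
    ring
  · rw [uIcc_of_le hp]
    exact continuousOn_const.div (by fun_prop) fun s hs => (pow_pos (hpos hs.1) 2).ne'
  · rintro _ ⟨s, hs, rfl⟩
    rw [uIcc_of_le hp] at hs
    refine ContinuousAt.continuousWithinAt ?_
    refine (continuousAt_id.rpow_const (Or.inr hα.le)).mul
      (ContinuousAt.rpow_const (by fun_prop) (Or.inl ?_))
    have := hpos hs.1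
    rw [hone hs.1]
    positivity

/-- Theorem 3.5: mixing the incomplete-Gamma default probabilities over a
Gamma-distributed rate `Λ` yields an incomplete Beta function. -/
theorem stmt17 (α c k θ : ℝ) (hα : 0 < α) (hc : 0 < c) (hk : 0 < k) (hθ : 0 < θ) :
    ∀ u : ℝ, 0 ≤ u →
      (∫ lam in Set.Ioi (0 : ℝ),
          ((1 / Real.Gamma (α + 1)) * ∫ z in (0 : ℝ)..(lam * u / c), z ^ α * Real.exp (-z)) *
            ((1 / (Real.Gamma k * θ ^ k)) * lam ^ (k - 1) * Real.exp (-(lam / θ))))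
        = (Real.Gamma (k + α + 1) / (Real.Gamma (α + 1) * Real.Gamma k)) *
            ∫ y in (0 : ℝ)..(u * θ / (c + u * θ)), y ^ α * (1 - y) ^ (k - 1) := by
  intro u hu
  have hp : 0 ≤ u / c := by positivity
  have hlim : u * θ / (c + u * θ) = u / c * θ / (1 + u / c * θ) := by
    field_simp
  have hmix {l : ℝ} (hl : l ∈ Ioi (0 : ℝ)) :
      ((1 / Gamma (α + 1)) * ∫ z in (0 : ℝ)..(l * u / c), z ^ α * exp (-z)) *
          ((1 / (Gamma k * θ ^ k)) * l ^ (k - 1) * exp (-(l / θ))) =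
        1 / (Gamma (α + 1) * (Gamma k * θ ^ k)) *
          ∫ s in Ioc 0 (u / c), s ^ α * (l ^ (k + α) * exp (-((s + 1 / θ) * l))) := by
    have hl : 0 < l := hl
    have hinner : ∫ s in Ioc 0 (u / c), s ^ α * (l ^ (k + α) * exp (-((s + 1 / θ) * l))) =
        l ^ (k - 1) * exp (-(l / θ)) *
          ∫ s in Ioc 0 (u / c), l ^ (α + 1) * (s ^ α * exp (-(l * s))) := by
      rw [← integral_const_mul]
      refine setIntegral_congr_fun measurableSet_Ioc fun s _ => ?_
      rw [show k + α = (k - 1) + (α + 1) by ring, rpow_add hl,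
        show -((s + 1 / θ) * l) = -(l / θ) + -(l * s) by ring, exp_add]
      ring
    rw [mul_div_assoc, integral_rpow_mul_exp_neg_comp_mul hl hp, hinner]
    ring
  rw [setIntegral_congr_fun measurableSet_Ioi fun l hl => hmix hl, integral_const_mul,
    integral_Ioi_integral_Ioc_rpow_mul_exp_neg hα hk (by positivity), hlim,
    integral_incompleteBeta_eq_integral_Ioc hα hθ hp, ← integral_const_mul,
    ← integral_const_mul]
  refine setIntegral_congr_fun measurableSet_Ioc fun s hs => ?_
  have hs0 := hs.1
  have hscale : (1 / (s + 1 / θ)) ^ (k + α + 1) =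
      θ ^ k * θ ^ (α + 1) * (1 / (1 + s * θ)) ^ (k + α + 1) := by
    rw [← rpow_add hθ, ← add_assoc, ← mul_rpow hθ.le (by positivity)]
    congr 1
    field_simp
    ring
  have hθk : θ ^ k ≠ 0 := (rpow_pos_of_pos hθ k).ne'
  rw [hscale]
  field_simp
end

section
/- Let (W,X) be a pair of positive random variables with joint density, c>0, and K_∞ the operator (K_∞ g)(u) = E[ 1_{{cW < u}} · g( e^{X}(u−cW) ) ]. Then for every integrable g:(0,∞)→ℝ and every n ≥ 0, ∫_0^∞ (K_∞ⁿ g)(u) du = E[e^{−X}]ⁿ · ∫_0^∞ g(z) dz; in particular, with ψ₀^∞(u) = P(W > u/c) and E[W]<∞, ∫_0^∞ (K_∞ⁿ ψ₀^∞)(u) du = c·E[e^{−X}]ⁿ·E[W]. -/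
open MeasureTheory ProbabilityTheory Real Set Filter

theorem Kinf_eq_integral_indicator {Ω : Type*} [MeasureSpace Ω] (c : ℝ) (W X : Ω → ℝ) (g : ℝ → ℝ) :
    Kinf c W X g = fun u => ∫ ω, (Set.Ioi (0 : ℝ)).indicator g
      (Real.exp (X ω) * (u - c * W ω)) ∂(ℙ : Measure Ω) := by
  funext u
  refine integral_congr_ae (ae_of_all _ fun ω => ?_)
  simp only [Set.indicator, Set.mem_Ioi, mul_pos_iff_of_pos_left (Real.exp_pos _), sub_pos]

theorem integral_comp_exp_mul_sub (f : ℝ → ℝ) (x b : ℝ) :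
    ∫ u, f (Real.exp x * (u - b)) = Real.exp (-x) * ∫ z, f z := by
  rw [integral_sub_right_eq_self (μ := volume) (fun u => f (Real.exp x * u)) b,
    Measure.integral_comp_mul_left, Real.exp_neg, abs_of_pos (inv_pos.2 (Real.exp_pos x)),
    smul_eq_mul]

theorem integrable_exp_neg_of_pos {Ω : Type*} [MeasureSpace Ω]
    [IsProbabilityMeasure (ℙ : Measure Ω)] {X : Ω → ℝ} (hX : Measurable X)
    (hXpos : ∀ ω, 0 < X ω) : Integrable (fun ω => Real.exp (-X ω)) (ℙ : Measure Ω) := by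
  refine Integrable.of_bound (by fun_prop) 1 (ae_of_all _ fun ω => ?_)
  rw [Real.norm_eq_abs, Real.abs_exp, Real.exp_le_one_iff]
  linarith [hXpos ω]

theorem measurable_Kinf {Ω : Type*} [MeasureSpace Ω] [IsProbabilityMeasure (ℙ : Measure Ω)]
    (c : ℝ) {W X : Ω → ℝ} (hW : Measurable W) (hX : Measurable X) {g : ℝ → ℝ}
    (hg : Measurable g) : Measurable (Kinf c W X g) := by
  rw [Kinf_eq_integral_indicator]
  have hF : Measurable (fun p : ℝ × Ω => (Set.Ioi (0 : ℝ)).indicator g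
      (Real.exp (X p.2) * (p.1 - c * W p.2))) :=
    (hg.indicator measurableSet_Ioi).comp (by fun_prop)
  exact hF.stronglyMeasurable.integral_prod_right'.measurable

theorem integrable_prod_comp_exp_mul_sub {Ω : Type*} [MeasureSpace Ω]
    [IsProbabilityMeasure (ℙ : Measure Ω)] {X B : Ω → ℝ} (hX : Measurable X)
    (hB : Measurable B) (hXpos : ∀ ω, 0 < X ω) {f : ℝ → ℝ} (hf : Measurable f)
    (hfi : Integrable f) :
    Integrable (fun p : ℝ × Ω => f (Real.exp (X p.2) * (p.1 - B p.2)))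
      ((volume : Measure ℝ).prod (ℙ : Measure Ω)) := by
  have hF : Measurable (fun p : ℝ × Ω => f (Real.exp (X p.2) * (p.1 - B p.2))) :=
    hf.comp (by fun_prop)
  rw [integrable_prod_iff' hF.aestronglyMeasurable]
  refine ⟨ae_of_all _ fun ω => ?_, ?_⟩
  · exact (hfi.comp_mul_left' (Real.exp_pos (X ω)).ne').comp_sub_right (B ω)
  · simp only [integral_comp_exp_mul_sub (fun z => ‖f z‖)]
    exact (integrable_exp_neg_of_pos hX hXpos).mul_const _

theorem integrable_Kinf {Ω : Type*} [MeasureSpace Ω] [IsProbabilityMeasure (ℙ : Measure Ω)]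
    (c : ℝ) {W X : Ω → ℝ} (hW : Measurable W) (hX : Measurable X)
    (hXpos : ∀ ω, 0 < X ω) {g : ℝ → ℝ} (hg : Measurable g)
    (hgi : IntegrableOn g (Set.Ioi (0 : ℝ))) : Integrable (Kinf c W X g) := by
  rw [Kinf_eq_integral_indicator]
  exact (integrable_prod_comp_exp_mul_sub hX (hW.const_mul c) hXpos
    (hg.indicator measurableSet_Ioi) (hgi.integrable_indicator measurableSet_Ioi)).integral_prod_left

theorem setIntegral_Ioi_Kinf {Ω : Type*} [MeasureSpace Ω] [IsProbabilityMeasure (ℙ : Measure Ω)]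
    {c : ℝ} (hc : 0 ≤ c) {W X : Ω → ℝ} (hW : Measurable W) (hX : Measurable X)
    (hWpos : ∀ ω, 0 < W ω) (hXpos : ∀ ω, 0 < X ω) {g : ℝ → ℝ} (hg : Measurable g)
    (hgi : IntegrableOn g (Set.Ioi (0 : ℝ))) :
    ∫ u in Set.Ioi (0 : ℝ), Kinf c W X g u
      = (∫ ω, Real.exp (-X ω) ∂(ℙ : Measure Ω)) * ∫ z in Set.Ioi (0 : ℝ), g z := by
  have hzero : ∀ u, u ∉ Set.Ioi (0 : ℝ) → Kinf c W X g u = 0 := by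
    intro u hu
    refine integral_eq_zero_of_ae (ae_of_all _ fun ω => if_neg ?_)
    have := mul_nonneg hc (hWpos ω).le
    exact not_lt.2 ((not_lt.1 hu).trans this)
  rw [setIntegral_eq_integral_of_forall_compl_eq_zero hzero, Kinf_eq_integral_indicator,
    integral_integral_swap (integrable_prod_comp_exp_mul_sub hX (hW.const_mul c) hXpos
      (hg.indicator measurableSet_Ioi) (hgi.integrable_indicator measurableSet_Ioi))]
  simp only [integral_comp_exp_mul_sub]
  rw [integral_mul_const, integral_indicator measurableSet_Ioi]

theorem setIntegral_Ioi_iterate_Kinf {Ω : Type*} [MeasureSpace Ω]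
    [IsProbabilityMeasure (ℙ : Measure Ω)]
    {c : ℝ} (hc : 0 ≤ c) {W X : Ω → ℝ} (hW : Measurable W) (hX : Measurable X)
    (hWpos : ∀ ω, 0 < W ω) (hXpos : ∀ ω, 0 < X ω) (n : ℕ) {g : ℝ → ℝ} (hg : Measurable g)
    (hgi : IntegrableOn g (Set.Ioi (0 : ℝ))) :
    ∫ u in Set.Ioi (0 : ℝ), ((fun g' => Kinf c W X g')^[n] g) u
      = (∫ ω, Real.exp (-X ω) ∂(ℙ : Measure Ω)) ^ n * ∫ z in Set.Ioi (0 : ℝ), g z := by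
  induction n generalizing g with
  | zero => simp
  | succ n ih =>
    rw [Function.iterate_succ_apply, ih (measurable_Kinf c hW hX hg)
      (integrable_Kinf c hW hX hXpos hg hgi).integrableOn,
      setIntegral_Ioi_Kinf hc hW hX hWpos hXpos hg hgi, pow_succ, mul_assoc]

theorem integrableOn_Ioi_measure_lt_toReal {Ω : Type*} [MeasurableSpace Ω] {μ : Measure Ω}
    [IsFiniteMeasure μ] {Y : Ω → ℝ} (hY : Integrable Y μ) (hYnn : 0 ≤ᵐ[μ] Y) :
    IntegrableOn (fun u => (μ {ω | u < Y ω}).toReal) (Set.Ioi (0 : ℝ)) := by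
  have hanti : Antitone fun u => μ {ω | u < Y ω} :=
    fun a b hab => measure_mono fun ω (hω : b < Y ω) => lt_of_le_of_lt hab hω
  refine integrable_toReal_of_lintegral_ne_top hanti.measurable.aemeasurable ?_
  rw [← lintegral_eq_lintegral_meas_lt μ hYnn hY.aemeasurable]
  exact hY.lintegral_lt_top.ne

/-- Lemma A.2: `∫_0^∞ (K_∞ⁿ g)(u) du = E[e^{-X}]ⁿ ∫_0^∞ g(z) dz`, and in particular
`∫_0^∞ (K_∞ⁿ ψ₀^∞)(u) du = c E[e^{-X}]ⁿ E[W]`. -/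
theorem stmt19 {Ω : Type*} [MeasureSpace Ω] [IsProbabilityMeasure (ℙ : Measure Ω)]
    (c : ℝ) (hc : 0 < c)
    (W₀ X₀ : Ω → ℝ) (hW₀ : Measurable W₀) (hX₀ : Measurable X₀)
    (hW₀pos : ∀ ω, 0 < W₀ ω) (hX₀pos : ∀ ω, 0 < X₀ ω)
    (hdens : Measure.map (fun ω => (W₀ ω, X₀ ω)) (ℙ : Measure Ω) ≪ (volume : Measure (ℝ × ℝ)))
    (hWint : Integrable W₀ (ℙ : Measure Ω)) :
    (∀ g : ℝ → ℝ, Measurable g → IntegrableOn g (Set.Ioi (0 : ℝ)) → ∀ n : ℕ,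
      (∫ u in Set.Ioi (0 : ℝ), ((fun g' => Kinf c W₀ X₀ g')^[n] g) u)
        = (∫ ω, Real.exp (-X₀ ω) ∂(ℙ : Measure Ω)) ^ n * ∫ z in Set.Ioi (0 : ℝ), g z)
    ∧ (∀ n : ℕ,
      (∫ u in Set.Ioi (0 : ℝ),
          ((fun g' => Kinf c W₀ X₀ g')^[n] (fun u => (ℙ {ω | u / c < W₀ ω}).toReal)) u)
        = c * (∫ ω, Real.exp (-X₀ ω) ∂(ℙ : Measure Ω)) ^ n * ∫ ω, W₀ ω ∂(ℙ : Measure Ω)) := by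
  refine ⟨fun g hg hgi n => setIntegral_Ioi_iterate_Kinf hc.le hW₀ hX₀ hW₀pos hX₀pos n hg hgi,
    fun n => ?_⟩
  have hψ : (fun u : ℝ => ((ℙ : Measure Ω) {ω | u / c < W₀ ω}).toReal)
      = fun u => ((ℙ : Measure Ω) {ω | u < c * W₀ ω}).toReal := by
    funext u
    simp only [div_lt_iff₀' hc]
  have hnn : 0 ≤ᵐ[(ℙ : Measure Ω)] fun ω => c * W₀ ω :=
    ae_of_all _ fun ω => (mul_pos hc (hW₀pos ω)).le
  have hanti : Antitone fun u : ℝ => ((ℙ : Measure Ω) {ω | u < c * W₀ ω}).toReal :=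
    fun a b hab => ENNReal.toReal_mono (measure_ne_top _ _)
      (measure_mono fun ω (hω : b < c * W₀ ω) => lt_of_le_of_lt hab hω)
  have hlayer : ∫ ω, c * W₀ ω ∂(ℙ : Measure Ω)
      = ∫ u in Set.Ioi (0 : ℝ), ((ℙ : Measure Ω) {ω | u < c * W₀ ω}).toReal :=
    (hWint.const_mul c).integral_eq_integral_meas_lt hnn
  rw [hψ, setIntegral_Ioi_iterate_Kinf hc.le hW₀ hX₀ hW₀pos hX₀pos n hanti.measurable
    (integrableOn_Ioi_measure_lt_toReal (hWint.const_mul c) hnn), ← hlayer, integral_const_mul]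
  ring
end
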